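/- Let a > 0 and let β₁ and (β_{2,ι})_{ι>0} be functions (0,∞) → [0,∞), each decreasing with limit 0 at ∞, with β₁(s) ≥ a·(1−s) for s ∈ (0,1). Assume that for every ι > 0, β_{2,ι} ≥ β₁ pointwise, and that for every s > 0, β_{2,ι}(s) → β₁(s) as ι → 0. Let F₁ and F_{2,ι} be the functions F_a built from β₁ and β_{2,ι} respectively. Then for every ι > 0 and every n ∈ ℕ, F_{2,ι}⁻¹(n) ≥ F₁⁻¹(n), and lim_{ι→0} sup_{n ≥ 0} ( F_{2,ι}⁻¹(n) − F₁⁻¹(n) ) = 0. -/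

import Mathlib

open MeasureTheory Filter
open scoped ENNReal

/-- `K(u) := u·β(1/u)` for `u ≠ 0`, with `K(0) := 0`. -/
noncomputable def Kfun (β : ℝ → ℝ) (u : ℝ) : ℝ := if u = 0 then 0 else u * β u⁻¹

/-- The convex conjugate `K*(v) := sup_{u ≥ 0} (u·v − K(u))`, valued in `[0,∞]`. -/
noncomputable def Kstar (β : ℝ → ℝ) (v : ℝ) : ℝ≥0∞ :=
  ⨆ u ∈ Set.Ici (0 : ℝ), ENNReal.ofReal (u * v - Kfun β u)

/-- `F_a(x) := ∫_x^a dv / K*(v)`. -/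
noncomputable def Fa (β : ℝ → ℝ) (a x : ℝ) : ℝ :=
  (∫⁻ v in Set.Ioc x a, (Kstar β v)⁻¹).toReal

theorem Kstar_mono (β : ℝ → ℝ) : Monotone (Kstar β) := by
  intro v w hvw
  refine iSup₂_mono fun u hu => ENNReal.ofReal_le_ofReal ?_
  have := mul_le_mul_of_nonneg_left hvw (Set.mem_Ici.1 hu)
  linarith

theorem Kfun_of_pos (β : ℝ → ℝ) {u : ℝ} (hu : 0 < u) : Kfun β u = u * β u⁻¹ :=
  if_neg hu.ne'

theorem Kstar_pos {β : ℝ → ℝ} (hlim : Tendsto β atTop (nhds 0)) {v : ℝ} (hv : 0 < v) :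
    0 < Kstar β v := by
  obtain ⟨s, hsv, hs⟩ := ((hlim.eventually_lt_const hv).and (eventually_gt_atTop 0)).exists
  have hu : 0 < s⁻¹ := inv_pos.2 hs
  refine lt_of_lt_of_le (ENNReal.ofReal_pos.2 ?_)
    (le_iSup₂ (f := fun u (_ : u ∈ Set.Ici (0 : ℝ)) => ENNReal.ofReal (u * v - Kfun β u))
      s⁻¹ (Set.mem_Ici.2 hu.le))
  rw [Kfun_of_pos β hu, inv_inv, ← mul_sub]
  exact mul_pos hu (sub_pos.2 hsv)

theorem Kstar_le {β : ℝ → ℝ} {a v : ℝ} (ha : 0 < a) (h0 : ∀ s, 0 < s → 0 ≤ β s)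
    (hβa : ∀ s ∈ Set.Ioo (0 : ℝ) 1, a * (1 - s) ≤ β s) (hv : v ≤ a) :
    Kstar β v ≤ ENNReal.ofReal a := by
  refine iSup₂_le fun u hu => ENNReal.ofReal_le_ofReal ?_
  rcases (Set.mem_Ici.1 hu).eq_or_lt with rfl | hu
  · simp [Kfun, ha.le]
  rw [Kfun_of_pos β hu]
  have huv : u * v ≤ u * a := mul_le_mul_of_nonneg_left hv hu.le
  rcases le_or_gt u 1 with h1 | h1
  · have := mul_nonneg hu.le (h0 _ (inv_pos.2 hu))
    nlinarith
  · have := mul_le_mul_of_nonneg_left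
      (hβa u⁻¹ ⟨inv_pos.2 hu, inv_lt_one_of_one_lt₀ h1⟩) hu.le
    have h2 : u * (a * (1 - u⁻¹)) = u * a - a := by field_simp
    linarith

theorem Kstar_anti {β γ : ℝ → ℝ} (h : ∀ s, 0 < s → β s ≤ γ s) (v : ℝ) :
    Kstar γ v ≤ Kstar β v := by
  refine iSup₂_mono fun u hu => ENNReal.ofReal_le_ofReal ?_
  rcases (Set.mem_Ici.1 hu).eq_or_lt with rfl | hu
  · simp [Kfun]
  rw [Kfun_of_pos β hu, Kfun_of_pos γ hu]
  have := mul_le_mul_of_nonneg_left (h _ (inv_pos.2 hu)) hu.le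
  linarith

theorem lintegral_inv_Kstar_ne_top {β : ℝ → ℝ} (hlim : Tendsto β atTop (nhds 0))
    (a : ℝ) {x : ℝ} (hx : 0 < x) :
    ∫⁻ v in Set.Ioc x a, (Kstar β v)⁻¹ ≠ ∞ := by
  have hle : ∫⁻ v in Set.Ioc x a, (Kstar β v)⁻¹ ≤ ∫⁻ _ in Set.Ioc x a, (Kstar β x)⁻¹ :=
    setLIntegral_mono measurable_const fun v hv =>
      ENNReal.inv_le_inv.2 (Kstar_mono β hv.1.le)
  refine ne_top_of_le_ne_top ?_ hle
  rw [setLIntegral_const, Real.volume_Ioc]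
  exact ENNReal.mul_ne_top (ENNReal.inv_ne_top.2 (Kstar_pos hlim hx).ne') ENNReal.ofReal_ne_top

theorem Fa_strictAntiOn {β : ℝ → ℝ} {a : ℝ} (ha : 0 < a) (h0 : ∀ s, 0 < s → 0 ≤ β s)
    (hβa : ∀ s ∈ Set.Ioo (0 : ℝ) 1, a * (1 - s) ≤ β s) (hlim : Tendsto β atTop (nhds 0)) :
    StrictAntiOn (Fa β a) (Set.Ioc 0 a) := by
  intro x hx y hy hxy
  have hsplit : ∫⁻ v in Set.Ioc x a, (Kstar β v)⁻¹ =
      (∫⁻ v in Set.Ioc x y, (Kstar β v)⁻¹) + ∫⁻ v in Set.Ioc y a, (Kstar β v)⁻¹ := by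
    rw [← lintegral_union measurableSet_Ioc (Set.Ioc_disjoint_Ioc_of_le le_rfl),
      Set.Ioc_union_Ioc_eq_Ioc hxy.le hy.2]
  have hpos : 0 < ∫⁻ v in Set.Ioc x y, (Kstar β v)⁻¹ := by
    have hle : ∫⁻ _ in Set.Ioc x y, (ENNReal.ofReal a)⁻¹ ≤
        ∫⁻ v in Set.Ioc x y, (Kstar β v)⁻¹ :=
      setLIntegral_mono (Kstar_mono β).measurable.inv fun v hv =>
        ENNReal.inv_le_inv.2 (Kstar_le ha h0 hβa (hv.2.trans hy.2))
    refine lt_of_lt_of_le ?_ hle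
    rw [setLIntegral_const, Real.volume_Ioc]
    exact ENNReal.mul_pos (ENNReal.inv_ne_zero.2 ENNReal.ofReal_ne_top)
      (ENNReal.ofReal_pos.2 (sub_pos.2 hxy)).ne'
  refine ENNReal.toReal_strict_mono (lintegral_inv_Kstar_ne_top hlim a hx.1) ?_
  rw [hsplit, add_comm]
  exact ENNReal.lt_add_right (lintegral_inv_Kstar_ne_top hlim a hy.1) hpos.ne'

theorem Fa_mono {β γ : ℝ → ℝ} (h : ∀ s, 0 < s → β s ≤ γ s)
    (hlim : Tendsto γ atTop (nhds 0)) (a : ℝ) {x : ℝ} (hx : 0 < x) :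
    Fa β a x ≤ Fa γ a x :=
  ENNReal.toReal_mono (lintegral_inv_Kstar_ne_top hlim a hx)
    (lintegral_mono fun v => ENNReal.inv_le_inv.2 (Kstar_anti h v))

theorem tendsto_Kstar {ι : Type*} {l : Filter ι} {β : ℝ → ℝ} {γ : ι → ℝ → ℝ}
    (hge : ∀ᶠ i in l, ∀ s, 0 < s → β s ≤ γ i s)
    (hconv : ∀ s, 0 < s → Tendsto (fun i => γ i s) l (nhds (β s))) (v : ℝ) :
    Tendsto (fun i => Kstar (γ i) v) l (nhds (Kstar β v)) := by
  refine tendsto_order.2 ⟨fun c hc => ?_, fun c hc => ?_⟩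
  · obtain ⟨u, hu⟩ := lt_iSup_iff.1 hc
    obtain ⟨hu0, hcu⟩ := lt_iSup_iff.1 hu
    have hK : Tendsto (fun i => Kfun (γ i) u) l (nhds (Kfun β u)) := by
      rcases (Set.mem_Ici.1 hu0).eq_or_lt with rfl | hu
      · simpa only [Kfun, if_true] using tendsto_const_nhds
      · simp only [Kfun_of_pos _ hu]
        exact (hconv _ (inv_pos.2 hu)).const_mul u
    have ht := ENNReal.tendsto_ofReal (hK.const_sub (u * v))
    filter_upwards [ht.eventually_const_lt hcu] with i hi
    exact hi.trans_le
      (le_iSup₂ (f := fun u (_ : u ∈ Set.Ici (0 : ℝ)) => ENNReal.ofReal (u * v - Kfun (γ i) u))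
        u hu0)
  · filter_upwards [hge] with i hi
    exact (Kstar_anti hi v).trans_lt hc

theorem tendsto_Fa {ι : Type*} {l : Filter ι} [l.IsCountablyGenerated]
    {β : ℝ → ℝ} {γ : ι → ℝ → ℝ} (hlim : Tendsto β atTop (nhds 0))
    (hge : ∀ᶠ i in l, ∀ s, 0 < s → β s ≤ γ i s)
    (hconv : ∀ s, 0 < s → Tendsto (fun i => γ i s) l (nhds (β s)))
    (a : ℝ) {x : ℝ} (hx : 0 < x) :
    Tendsto (fun i => Fa (γ i) a x) l (nhds (Fa β a x)) := by
  have hinv (v : ℝ) : Tendsto (fun i => (Kstar (γ i) v)⁻¹) l (nhds (Kstar β v)⁻¹) :=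
    (tendsto_Kstar hge hconv v).inv
  obtain ⟨C, hC, hCtop⟩ := exists_between
    (ENNReal.inv_lt_top.2 (Kstar_pos hlim hx))
  refine (ENNReal.tendsto_toReal (lintegral_inv_Kstar_ne_top hlim a hx)).comp ?_
  refine tendsto_lintegral_filter_of_dominated_convergence (fun _ => C)
    (Eventually.of_forall fun i => (Kstar_mono (γ i)).measurable.inv) ?_ ?_
    (Eventually.of_forall hinv)
  · filter_upwards [(hinv x).eventually_lt_const hC] with i hi
    filter_upwards [ae_restrict_mem measurableSet_Ioc] with v hv
    exact (ENNReal.inv_le_inv.2 (Kstar_mono (γ i) hv.1.le)).trans hi.le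
  · rw [setLIntegral_const, Real.volume_Ioc]
    exact ENNReal.mul_ne_top hCtop.ne ENNReal.ofReal_ne_top

/-- Proposition (convergence of super-Poincaré functions implies convergence of rates):
if `β_{2,ι} ≥ β₁` pointwise and `β_{2,ι}(s) → β₁(s)` as `ι → 0`, then
`F_{2,ι}⁻¹(n) ≥ F₁⁻¹(n)` for all `n`, and `sup_{n ≥ 0} (F_{2,ι}⁻¹(n) − F₁⁻¹(n)) → 0`
as `ι → 0`. -/
theorem stmt17 (a : ℝ) (ha : 0 < a)
    (β₁ : ℝ → ℝ) (β₂ : ℝ → ℝ → ℝ)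
    (hβ₁0 : ∀ s : ℝ, 0 < s → 0 ≤ β₁ s)
    (hβ₁dec : AntitoneOn β₁ (Set.Ioi 0))
    (hβ₁lim : Tendsto β₁ atTop (nhds 0))
    (hβ₁a : ∀ s ∈ Set.Ioo (0 : ℝ) 1, a * (1 - s) ≤ β₁ s)
    (hβ₂0 : ∀ ι : ℝ, 0 < ι → ∀ s : ℝ, 0 < s → 0 ≤ β₂ ι s)
    (hβ₂dec : ∀ ι : ℝ, 0 < ι → AntitoneOn (β₂ ι) (Set.Ioi 0))
    (hβ₂lim : ∀ ι : ℝ, 0 < ι → Tendsto (β₂ ι) atTop (nhds 0))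
    (hge : ∀ ι : ℝ, 0 < ι → ∀ s : ℝ, 0 < s → β₁ s ≤ β₂ ι s)
    (hconv : ∀ s : ℝ, 0 < s →
      Tendsto (fun ι => β₂ ι s) (nhdsWithin 0 (Set.Ioi 0)) (nhds (β₁ s)))
    (F₁inv : ℝ → ℝ)
    (hF₁inv : ∀ x : ℝ, 0 ≤ x → F₁inv x ∈ Set.Ioc 0 a ∧ Fa β₁ a (F₁inv x) = x)
    (F₂inv : ℝ → ℝ → ℝ)
    (hF₂inv : ∀ ι : ℝ, 0 < ι → ∀ x : ℝ, 0 ≤ x →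
      F₂inv ι x ∈ Set.Ioc 0 a ∧ Fa (β₂ ι) a (F₂inv ι x) = x) :
    (∀ ι : ℝ, 0 < ι → ∀ n : ℕ, F₁inv (n : ℝ) ≤ F₂inv ι (n : ℝ)) ∧
    Tendsto (fun ι => ⨆ n : ℕ, (F₂inv ι (n : ℝ) - F₁inv (n : ℝ)))
      (nhdsWithin 0 (Set.Ioi 0)) (nhds 0) := by
  have hanti₁ := Fa_strictAntiOn ha hβ₁0 hβ₁a hβ₁lim
  have hanti₂ (ι : ℝ) (hι : 0 < ι) : StrictAntiOn (Fa (β₂ ι) a) (Set.Ioc 0 a) :=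
    Fa_strictAntiOn ha (hβ₂0 ι hι)
      (fun s hs => (hβ₁a s hs).trans (hge ι hι s hs.1)) (hβ₂lim ι hι)
  have hle (ι : ℝ) (hι : 0 < ι) (n : ℕ) : F₁inv n ≤ F₂inv ι n := by
    obtain ⟨h1, e1⟩ := hF₁inv n n.cast_nonneg
    obtain ⟨h2, e2⟩ := hF₂inv ι hι n n.cast_nonneg
    rw [← hanti₁.le_iff_ge h2 h1, e1]
    exact (Fa_mono (hge ι hι) (hβ₂lim ι hι) a h2.1).trans_eq e2
  refine ⟨hle, ?_⟩
  have hpos : ∀ᶠ ι : ℝ in nhdsWithin 0 (Set.Ioi 0), 0 < ι := eventually_mem_nhdsWithin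
  have hge' : ∀ᶠ ι : ℝ in nhdsWithin 0 (Set.Ioi 0), ∀ s, 0 < s → β₁ s ≤ β₂ ι s :=
    hpos.mono hge
  have hlt (ε : ℝ) (hε : 0 < ε) (n : ℕ) :
      ∀ᶠ ι in nhdsWithin 0 (Set.Ioi 0), F₂inv ι n < F₁inv n + ε := by
    obtain ⟨h1, e1⟩ := hF₁inv n n.cast_nonneg
    rcases lt_or_ge a (F₁inv n + ε) with hay | hay
    · filter_upwards [hpos] with ι hι
      exact (hF₂inv ι hι n n.cast_nonneg).1.2.trans_lt hay
    · have hy : F₁inv n + ε ∈ Set.Ioc 0 a := ⟨add_pos h1.1 hε, hay⟩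
      have hFy : Fa β₁ a (F₁inv n + ε) < n :=
        (hanti₁ h1 hy (lt_add_of_pos_right _ hε)).trans_eq e1
      filter_upwards [hpos,
        (tendsto_Fa hβ₁lim hge' hconv a hy.1).eventually_lt_const hFy] with ι hι hF
      obtain ⟨h2, e2⟩ := hF₂inv ι hι n n.cast_nonneg
      rw [← hanti₂ ι hι |>.lt_iff_gt hy h2, e2]
      exact hF
  refine Metric.tendsto_nhds.2 fun ε hε => ?_
  obtain ⟨N, hN⟩ : ∃ N : ℕ, F₁inv N ≤ ε / 4 := by
    have hδ : min a (ε / 4) ∈ Set.Ioc 0 a := ⟨lt_min ha (by positivity), min_le_left _ _⟩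
    obtain ⟨N, hN⟩ := exists_nat_ge (Fa β₁ a (min a (ε / 4)))
    obtain ⟨h1, e1⟩ := hF₁inv N N.cast_nonneg
    refine ⟨N, le_trans ?_ (min_le_right a _)⟩
    rw [← hanti₁.le_iff_ge hδ h1, e1]
    exact hN
  have hfin : ∀ᶠ ι in nhdsWithin 0 (Set.Ioi 0), ∀ n ∈ Set.Iic N,
      F₂inv ι n < F₁inv n + ε / 4 :=
    (eventually_all_finite (Set.finite_Iic N)).2 fun n _ => hlt _ (by positivity) n
  filter_upwards [hpos, hfin] with ι hι hfin
  have hsup : ⨆ n : ℕ, (F₂inv ι n - F₁inv n) ≤ ε / 2 := by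
    refine ciSup_le fun n => ?_
    rcases le_or_gt n N with hn | hn
    · linarith [hfin n hn]
    · have hmono : F₂inv ι n ≤ F₂inv ι N := by
        obtain ⟨h2, e2⟩ := hF₂inv ι hι n n.cast_nonneg
        obtain ⟨h2', e2'⟩ := hF₂inv ι hι N N.cast_nonneg
        rw [← (hanti₂ ι hι).le_iff_ge h2' h2, e2, e2']
        exact_mod_cast hn.le
      linarith [hfin N Set.self_mem_Iic, (hF₁inv n n.cast_nonneg).1.1]
  have hnonneg : 0 ≤ ⨆ n : ℕ, (F₂inv ι n - F₁inv n) :=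
    Real.iSup_nonneg fun n => sub_nonneg.2 (hle ι hι n)
  rw [Real.dist_0_eq_abs, abs_of_nonneg hnonneg]
  linarith
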